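/- Let β > 0 and let G : (0,∞) → ℝ be continuously differentiable with lim_{x→∞} |G(x)|·x^{−ε} = 0 and lim_{x→∞} |x·G'(x)|·x^{−ε} = 0 for every ε > 0. Set g(x) = G(1/(1−x)) for x ∈ [0,1) and F(x) = (1−x)^β · g(x). Then lim_{t→∞} t · ∫₀¹ F(s)·( F(s) − √(t/(1+t)) · F( (t/(t+1))·s ) ) ds = 0. -/

import Mathlib

open Real Filter MeasureTheory intervalIntegral

/-- A continuous function on `(0,∞)` growing slower than `x^ε` is at most `C x^ε` on `[1,∞)`. -/
lemma exists_abs_le_mul_rpow {f : ℝ → ℝ} {ε : ℝ} (hf : ContinuousOn f (Set.Ioi 0))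
    (hlim : Tendsto (fun x : ℝ => |f x| * x ^ (-ε)) atTop (nhds 0)) :
    ∃ C : ℝ, 0 ≤ C ∧ ∀ y : ℝ, 1 ≤ y → |f y| ≤ C * y ^ ε := by
  obtain ⟨N, hN⟩ := eventually_atTop.1 (hlim.eventually (gt_mem_nhds one_pos))
  have hcont : ContinuousOn (fun x : ℝ => |f x| * x ^ (-ε)) (Set.Icc 1 N) := by
    have hsub : Set.Icc (1:ℝ) N ⊆ Set.Ioi 0 := fun x hx => lt_of_lt_of_le one_pos hx.1
    refine (hf.mono hsub).abs.mul ?_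
    exact continuousOn_id.rpow_const fun x hx => Or.inl (ne_of_gt (hsub hx))
  obtain ⟨K, hK⟩ := isCompact_Icc.exists_bound_of_continuousOn hcont
  refine ⟨max 1 K, le_max_of_le_left zero_le_one, fun y hy => ?_⟩
  have hy0 : 0 < y := by linarith
  have key : |f y| * y ^ (-ε) ≤ max 1 K := by
    rcases le_total y N with h | h
    · exact (le_abs_self _).trans ((hK y ⟨hy, h⟩).trans (le_max_right _ _))
    · exact (hN y h).le.trans (le_max_left _ _)
  rwa [rpow_neg hy0.le, ← div_eq_mul_inv, div_le_iff₀ (rpow_pos_of_pos hy0 _)] at key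

lemma tendsto_mul_sub_sqrt_mul_comp_mul {H : ℝ → ℝ} {s H' : ℝ} (hH : HasDerivAt H H' s) :
    Tendsto (fun t : ℝ => t * (H s - √(t / (1 + t)) * H (t / (t + 1) * s))) atTop
      (nhds (H s / 2 + s * H')) := by
  have hφ : HasDerivAt (fun u : ℝ => √u * H (u * s)) (H s / 2 + s * H') 1 := by
    have h1 : HasDerivAt (fun u : ℝ => u * s) s 1 := by
      simpa using (hasDerivAt_id (1:ℝ)).mul_const s
    have h2 : HasDerivAt (fun u : ℝ => H (u * s)) (H' * s) 1 :=
      HasDerivAt.comp (1:ℝ) (by simpa using hH) h1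
    refine ((Real.hasDerivAt_sqrt one_ne_zero).fun_mul h2).congr_deriv ?_
    simp only [sqrt_one, one_mul, mul_one]
    ring
  have hq : Tendsto (fun t : ℝ => t / (t + 1)) atTop (nhds 1) := by
    have h : Tendsto (fun t : ℝ => 1 - (t + 1)⁻¹) atTop (nhds (1 - 0)) :=
      tendsto_const_nhds.sub (tendsto_inv_atTop_zero.comp (tendsto_atTop_add_const_right _ 1 tendsto_id))
    rw [sub_zero] at h
    refine h.congr' ?_
    filter_upwards [eventually_gt_atTop 0] with t ht
    field_simp
    ring
  have hq' : Tendsto (fun t : ℝ => t / (t + 1)) atTop (nhdsWithin 1 {1}ᶜ) := by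
    refine tendsto_nhdsWithin_iff.2 ⟨hq, ?_⟩
    filter_upwards [eventually_gt_atTop 0] with t ht
    have : t / (t + 1) < 1 := by rw [div_lt_one (by linarith)]; linarith
    exact this.ne
  have hlim := hq.mul ((hasDerivAt_iff_tendsto_slope.1 hφ).comp hq')
  rw [one_mul] at hlim
  refine hlim.congr' ?_
  filter_upwards [eventually_gt_atTop 0] with t ht
  have h1 : t / (t + 1) - 1 = -(1 / (t + 1)) := by field_simp; ring
  simp only [Function.comp, slope_def_field, h1, sqrt_one, one_mul, add_comm 1 t]
  field_simp
  ring

lemma abs_mul_sub_sqrt_mul_comp_mul_le {H : ℝ → ℝ} {C γ s t : ℝ} (hC : 0 ≤ C)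
    (hγ0 : 0 < γ) (hγ1 : γ ≤ 1)
    (hdiff : ∀ x ∈ Set.Ioo (0:ℝ) 1, DifferentiableAt ℝ H x)
    (hH : ∀ x ∈ Set.Ioo (0:ℝ) 1, |H x| ≤ C * (1 - x) ^ γ)
    (hH' : ∀ x ∈ Set.Ioo (0:ℝ) 1, |deriv H x| ≤ C * (1 - x) ^ (γ - 1))
    (hs : s ∈ Set.Ioo (0:ℝ) 1) (ht : 0 < t) :
    |t * (H s - √(t / (1 + t)) * H (t / (t + 1) * s))| ≤ 2 * C * (1 - s) ^ (γ - 1) := by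
  obtain ⟨hs0, hs1⟩ := hs
  set q := t / (t + 1) with hq
  have hq0 : 0 < q := by positivity
  have hq1 : q < 1 := by rw [hq, div_lt_one (by linarith)]; linarith
  have htq : t * (1 - q) = q := by rw [hq]; field_simp; ring
  have hqs : q * s < s := by nlinarith
  have hqs0 : 0 < q * s := by positivity
  have hpow : 1 ≤ (1 - s) ^ (γ - 1) :=
    one_le_rpow_of_pos_of_le_one_of_nonpos (by linarith) (by linarith) (by linarith)
  have hHb : |H (q * s)| ≤ C := by
    refine (hH _ ⟨hqs0, by linarith⟩).trans ?_
    exact mul_le_of_le_one_right hC (rpow_le_one (by linarith) (by linarith) hγ0.le)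
  have hmv : |H s - H (q * s)| ≤ C * (1 - s) ^ (γ - 1) * (s - q * s) := by
    have := (convex_Icc (q * s) s).norm_image_sub_le_of_norm_deriv_le (f := H)
      (C := C * (1 - s) ^ (γ - 1)) (x := q * s) (y := s)
      (fun x hx => hdiff x ⟨by linarith [hx.1], by linarith [hx.2]⟩)
      (fun x hx => (hH' x ⟨by linarith [hx.1], by linarith [hx.2]⟩).trans
        (mul_le_mul_of_nonneg_left
          (rpow_le_rpow_of_nonpos (by linarith) (by linarith [hx.2]) (by linarith)) hC))
      ⟨le_rfl, hqs.le⟩ ⟨hqs.le, le_rfl⟩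
    rwa [norm_eq_abs, norm_eq_abs, abs_of_pos (sub_pos.2 hqs)] at this
  have hsq : q ≤ √q := le_sqrt_of_sq_le (by nlinarith)
  have hsq1 : √q ≤ 1 := sqrt_le_one.2 hq1.le
  have hsplit : |H s - √q * H (q * s)| ≤ 2 * C * (1 - s) ^ (γ - 1) * (1 - q) := by
    have e : H s - √q * H (q * s) = (H s - H (q * s)) + (1 - √q) * H (q * s) := by ring
    have h2 : |(1 - √q) * H (q * s)| ≤ (1 - q) * C := by
      rw [abs_mul, abs_of_nonneg (by linarith)]
      exact mul_le_mul (by linarith) hHb (abs_nonneg _) (by linarith)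
    have h3 : C * (1 - s) ^ (γ - 1) * (s - q * s) ≤ C * (1 - s) ^ (γ - 1) * (1 - q) :=
      mul_le_mul_of_nonneg_left (by nlinarith) (by positivity)
    have h4 : (1 - q) * C ≤ C * (1 - s) ^ (γ - 1) * (1 - q) := by
      rw [mul_comm]
      exact mul_le_mul_of_nonneg_right (le_mul_of_one_le_right hC hpow) (by linarith)
    rw [e]
    linarith [abs_add_le (H s - H (q * s)) ((1 - √q) * H (q * s))]
  rw [add_comm 1 t, ← hq, abs_mul, abs_of_pos ht]
  calc t * |H s - √q * H (q * s)|
      ≤ t * (2 * C * (1 - s) ^ (γ - 1) * (1 - q)) := mul_le_mul_of_nonneg_left hsplit ht.le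
    _ = 2 * C * (1 - s) ^ (γ - 1) * q := by rw [mul_left_comm, htq]
    _ ≤ 2 * C * (1 - s) ^ (γ - 1) := mul_le_of_le_one_right (by positivity) hq1.le

lemma integrableOn_one_sub_rpow {γ : ℝ} (hγ : 0 < γ) :
    IntegrableOn (fun s : ℝ => (1 - s) ^ (γ - 1)) (Set.Ioo 0 1) := by
  have h := (intervalIntegrable_rpow' (a := 0) (b := 1) (r := γ - 1) (by linarith)).comp_sub_left 1
  rw [sub_zero, sub_self] at h
  exact ((intervalIntegrable_iff_integrableOn_Ioo_of_le zero_le_one).1 h.symm)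

lemma tendsto_mul_integral_sub_sqrt {H : ℝ → ℝ} {C γ : ℝ} (hC : 0 ≤ C)
    (hγ0 : 0 < γ) (hγ1 : γ ≤ 1)
    (hdiff : ∀ x ∈ Set.Ioo (0:ℝ) 1, DifferentiableAt ℝ H x)
    (hH : ∀ x ∈ Set.Ioo (0:ℝ) 1, |H x| ≤ C * (1 - x) ^ γ)
    (hH' : ∀ x ∈ Set.Ioo (0:ℝ) 1, |deriv H x| ≤ C * (1 - x) ^ (γ - 1)) :
    Tendsto (fun t : ℝ => t * ∫ s in (0:ℝ)..1, H s * (H s - √(t / (1 + t)) * H (t / (t + 1) * s)))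
      atTop (nhds 0) := by
  have hcont : ContinuousOn H (Set.Ioo 0 1) := fun x hx => (hdiff x hx).continuousAt.continuousWithinAt
  have hHb : ∀ x ∈ Set.Ioo (0:ℝ) 1, |H x| ≤ C := fun x hx => (hH x hx).trans <|
    mul_le_of_le_one_right hC (rpow_le_one (by linarith [hx.2]) (by linarith [hx.1]) hγ0.le)
  have hbound : Integrable (fun s : ℝ => C * (2 * C * (1 - s) ^ (γ - 1)))
      (volume.restrict (Set.Ioo 0 1)) :=
    ((integrableOn_one_sub_rpow hγ0).const_mul (2 * C)).const_mul C
  have hle : ∀ t : ℝ, 0 < t → ∀ s ∈ Set.Ioo (0:ℝ) 1,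
      ‖H s * (t * (H s - √(t / (1 + t)) * H (t / (t + 1) * s)))‖ ≤
        C * (2 * C * (1 - s) ^ (γ - 1)) := fun t ht s hs => by
    rw [norm_eq_abs, abs_mul]
    exact mul_le_mul (hHb s hs) (abs_mul_sub_sqrt_mul_comp_mul_le hC hγ0 hγ1 hdiff hH hH' hs ht)
      (abs_nonneg _) hC
  have hlim : ∀ s ∈ Set.Ioo (0:ℝ) 1,
      Tendsto (fun t : ℝ => H s * (t * (H s - √(t / (1 + t)) * H (t / (t + 1) * s)))) atTop
        (nhds (H s * (H s / 2 + s * deriv H s))) := fun s hs =>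
    (tendsto_mul_sub_sqrt_mul_comp_mul (hdiff s hs).hasDerivAt).const_mul (H s)
  have hDCT := tendsto_integral_filter_of_dominated_convergence
    (μ := volume.restrict (Set.Ioo (0:ℝ) 1)) (l := atTop)
    (F := fun (t : ℝ) s => H s * (t * (H s - √(t / (1 + t)) * H (t / (t + 1) * s))))
    (f := fun s => H s * (H s / 2 + s * deriv H s))
    (fun s => C * (2 * C * (1 - s) ^ (γ - 1)))
    (by
      filter_upwards [eventually_gt_atTop 0] with t ht
      refine ContinuousOn.aestronglyMeasurable ?_ measurableSet_Ioo
      have hcomp : ContinuousOn (fun s => H (t / (t + 1) * s)) (Set.Ioo 0 1) := by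
        refine hcont.comp (by fun_prop) fun s hs => ⟨?_, ?_⟩
        · have := hs.1
          positivity
        · have : t / (t + 1) ≤ 1 := by rw [div_le_one (by linarith)]; linarith
          nlinarith [hs.1, hs.2]
      exact hcont.mul (continuousOn_const.mul (hcont.sub (continuousOn_const.mul hcomp))))
    (by
      filter_upwards [eventually_gt_atTop 0] with t ht
      exact (ae_restrict_mem measurableSet_Ioo).mono (hle t ht))
    hbound
    ((ae_restrict_mem measurableSet_Ioo).mono hlim)
  have hint : IntervalIntegrable (fun s => H s * (H s / 2 + s * deriv H s)) volume 0 1 := by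
    refine (intervalIntegrable_iff_integrableOn_Ioo_of_le zero_le_one).2 ?_
    refine hbound.mono' ?_ ?_
    · have h1 : AEStronglyMeasurable H (volume.restrict (Set.Ioo (0:ℝ) 1)) :=
        hcont.aestronglyMeasurable measurableSet_Ioo
      have h2 : AEStronglyMeasurable (fun s => s * deriv H s)
          (volume.restrict (Set.Ioo (0:ℝ) 1)) :=
        (measurable_id.mul (measurable_deriv H)).aestronglyMeasurable
      simp only [div_eq_mul_inv]
      exact h1.mul ((h1.mul_const 2⁻¹).add h2)
    · refine (ae_restrict_mem measurableSet_Ioo).mono fun s hs => ?_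
      refine le_of_tendsto (hlim s hs).norm ?_
      filter_upwards [eventually_gt_atTop 0] with t ht using hle t ht s hs
  have hzero : ∫ s in (0:ℝ)..1, H s * (H s / 2 + s * deriv H s) = 0 := by
    have hev : ∀ x ∈ Set.Ioo (0:ℝ) 1, ‖x * H x ^ 2 / 2‖ ≤ x * (C * (C * (1 - x) ^ γ)) := by
      intro x hx
      have h1 : H x ^ 2 ≤ C * (C * (1 - x) ^ γ) := by
        rw [← sq_abs, sq]
        exact mul_le_mul (hHb x hx) (hH x hx) (abs_nonneg _) hC
      have h2 := mul_le_mul_of_nonneg_left h1 hx.1.le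
      have h3 : 0 ≤ x * H x ^ 2 := mul_nonneg hx.1.le (sq_nonneg _)
      rw [norm_eq_abs, abs_of_nonneg (by linarith)]
      linarith
    have hbd : Continuous fun x : ℝ => x * (C * (C * (1 - x) ^ γ)) := by
      have : Continuous fun x : ℝ => (1 - x) ^ γ :=
        (continuous_const.sub continuous_id).rpow_const fun _ => Or.inr hγ0.le
      fun_prop
    have := integral_eq_sub_of_hasDerivAt_of_tendsto (f := fun x => x * H x ^ 2 / 2) (fa := 0)
      (fb := 0) zero_lt_one (fun x hx => ?_) hint ?_ ?_
    · rw [this, sub_zero]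
    · refine (((hasDerivAt_id x).fun_mul
        ((hdiff x hx).hasDerivAt.fun_pow 2)).div_const 2).congr_deriv ?_
      simp only [id]
      ring
    · refine squeeze_zero_norm' (Filter.mem_of_superset (Ioo_mem_nhdsGT zero_lt_one) hev) ?_
      simpa using (hbd.tendsto 0).mono_left nhdsWithin_le_nhds
    · refine squeeze_zero_norm' (Filter.mem_of_superset (Ioo_mem_nhdsLT zero_lt_one) hev) ?_
      simpa [hγ0.ne'] using (hbd.tendsto 1).mono_left nhdsWithin_le_nhds
  rw [integral_of_le zero_le_one, integral_Ioc_eq_integral_Ioo] at hzero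
  rw [hzero] at hDCT
  refine hDCT.congr fun t => ?_
  rw [integral_of_le zero_le_one, integral_Ioc_eq_integral_Ioo, ← MeasureTheory.integral_const_mul]
  congr 1
  ext s
  ring

/-- For `F(x) = (1−x)^β g(x)` with `g ∈ 𝒢`:
`t ∫₀¹ F(s)(F(s) − √(t/(1+t)) F((t/(t+1))s)) ds → 0` as `t → ∞`. -/
theorem limit_F_sqrt_difference (β : ℝ) (hβ : 0 < β) (G : ℝ → ℝ)
    (hG : ContDiffOn ℝ 1 G (Set.Ioi 0))
    (hGgrowth : ∀ ε : ℝ, 0 < ε →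
      Tendsto (fun x : ℝ => |G x| * x ^ (-ε)) atTop (nhds 0))
    (hG'growth : ∀ ε : ℝ, 0 < ε →
      Tendsto (fun x : ℝ => |x * deriv G x| * x ^ (-ε)) atTop (nhds 0))
    (F : ℝ → ℝ)
    (hF : ∀ x : ℝ, 0 ≤ x → x < 1 → F x = (1 - x) ^ β * G (1 / (1 - x))) :
    Tendsto (fun t : ℝ =>
        t * ∫ s in (0:ℝ)..1,
          F s * (F s - Real.sqrt (t / (1 + t)) * F ((t / (t + 1)) * s)))
      atTop (nhds 0) := by
  set γ := min β 1 / 2 with hγ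
  have hγ0 : 0 < γ := by have := lt_min hβ one_pos; linarith
  have hγβ : 2 * γ ≤ β := by have := min_le_left β 1; linarith
  have hγ1 : γ ≤ 1 := by have := min_le_right β 1; linarith
  obtain ⟨A, hA0, hA⟩ := exists_abs_le_mul_rpow hG.continuousOn (hGgrowth γ hγ0)
  obtain ⟨B, hB0, hB⟩ := exists_abs_le_mul_rpow (f := fun x => x * deriv G x)
    (continuousOn_id.mul (hG.continuousOn_deriv_of_isOpen isOpen_Ioi le_rfl)) (hG'growth γ hγ0)
  have hderiv : ∀ x ∈ Set.Ioo (0:ℝ) 1, HasDerivAt F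
      ((1 - x) ^ (β - 1) * (1 / (1 - x) * deriv G (1 / (1 - x)) - β * G (1 / (1 - x)))) x := by
    intro x hx
    have hx1 : 0 < 1 - x := by linarith [hx.2]
    have hy : 0 < 1 / (1 - x) := by positivity
    have heq : (fun x => (1 - x) ^ β * G (1 / (1 - x))) =ᶠ[nhds x] F :=
      Filter.mem_of_superset (Ioo_mem_nhds hx.1 hx.2) fun z hz => (hF z hz.1.le hz.2).symm
    refine HasDerivAt.congr_of_eventuallyEq ?_ heq.symm
    have hsub : HasDerivAt (fun z : ℝ => 1 - z) (-1) x := by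
      simpa using (hasDerivAt_id x).const_sub 1
    have hinv : HasDerivAt (fun z : ℝ => 1 / (1 - z)) (1 / (1 - x) ^ 2) x := by
      simpa using hsub.fun_inv hx1.ne'
    have hGd : HasDerivAt G (deriv G (1 / (1 - x))) (1 / (1 - x)) :=
      ((hG.differentiableOn one_ne_zero).differentiableAt (Ioi_mem_nhds hy)).hasDerivAt
    refine ((hsub.rpow_const (p := β) (Or.inl hx1.ne')).fun_mul
      (hGd.comp x hinv)).congr_deriv ?_
    have : (1 - x) ^ β = (1 - x) ^ (β - 1) * (1 - x) := by
      rw [← rpow_add_one hx1.ne', sub_add_cancel]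
    rw [this]
    simp only [Function.comp]
    field_simp
    ring
  have hpow : ∀ x ∈ Set.Ioo (0:ℝ) 1, 1 ≤ 1 / (1 - x) ∧
      ∀ p r : ℝ, r + γ ≤ p → (1 - x) ^ p * (1 / (1 - x)) ^ γ ≤ (1 - x) ^ r := by
    intro x hx
    have hx1 : 0 < 1 - x := by linarith [hx.2]
    refine ⟨(one_le_div hx1).2 (by linarith [hx.1]), fun p r hpr => ?_⟩
    rw [one_div, inv_rpow hx1.le, ← rpow_neg hx1.le, ← rpow_add hx1]
    exact rpow_le_rpow_of_exponent_ge hx1 (by linarith [hx.1]) (by linarith)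
  have hβA : 0 ≤ β * A := by positivity
  refine tendsto_mul_integral_sub_sqrt (C := A + B + β * A) (by positivity) hγ0 hγ1
    (fun x hx => (hderiv x hx).differentiableAt) (fun x hx => ?_) (fun x hx => ?_)
  · obtain ⟨hy, hp⟩ := hpow x hx
    have hx1 : 0 < 1 - x := by linarith [hx.2]
    rw [hF x hx.1.le hx.2, abs_mul, abs_of_pos (rpow_pos_of_pos hx1 _)]
    calc (1 - x) ^ β * |G (1 / (1 - x))|
        ≤ (1 - x) ^ β * (A * (1 / (1 - x)) ^ γ) :=
          mul_le_mul_of_nonneg_left (hA _ hy) (by positivity)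
      _ = A * ((1 - x) ^ β * (1 / (1 - x)) ^ γ) := by ring
      _ ≤ A * (1 - x) ^ γ := mul_le_mul_of_nonneg_left (hp _ _ (by linarith)) hA0
      _ ≤ (A + B + β * A) * (1 - x) ^ γ :=
          mul_le_mul_of_nonneg_right (by linarith) (by positivity)
  · obtain ⟨hy, hp⟩ := hpow x hx
    have hx1 : 0 < 1 - x := by linarith [hx.2]
    rw [(hderiv x hx).deriv, abs_mul, abs_of_pos (rpow_pos_of_pos hx1 _)]
    have hsum : |1 / (1 - x) * deriv G (1 / (1 - x)) - β * G (1 / (1 - x))| ≤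
        (B + β * A) * (1 / (1 - x)) ^ γ := by
      refine (abs_sub _ _).trans ?_
      rw [abs_mul β, abs_of_pos hβ]
      linarith [hB _ hy, mul_le_mul_of_nonneg_left (hA _ hy) hβ.le]
    calc (1 - x) ^ (β - 1) * |1 / (1 - x) * deriv G (1 / (1 - x)) - β * G (1 / (1 - x))|
        ≤ (1 - x) ^ (β - 1) * ((B + β * A) * (1 / (1 - x)) ^ γ) :=
          mul_le_mul_of_nonneg_left hsum (by positivity)
      _ = (B + β * A) * ((1 - x) ^ (β - 1) * (1 / (1 - x)) ^ γ) := by ring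
      _ ≤ (B + β * A) * (1 - x) ^ (γ - 1) :=
          mul_le_mul_of_nonneg_left (hp _ _ (by linarith)) (by positivity)
      _ ≤ (A + B + β * A) * (1 - x) ^ (γ - 1) :=
          mul_le_mul_of_nonneg_right (by linarith) (by positivity)
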